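/- arXiv:1810.04336 — 2 statements merged into one kernel-verified Lean document; each statement's English description precedes it below -/
import Mathlib

section
/- Let 𝒳 = [0, s]^d ⊆ ℝ^d be a hypercube with side length s > 0, let f : ℝ^d → ℝ be L-Lipschitz with respect to the Euclidean norm with L > 0, let x* ∈ 𝒳 be a global maximizer of f on 𝒳, and let ε > 0 satisfy ε/L ≤ s. If X is a point chosen uniformly at random from 𝒳 (i.e. distributed according to normalized Lebesgue measure on 𝒳), then the probability that f(x*) - f(X) ≤ ε is at least π^{d/2} (ε/L)^d / (2^d · Γ(d/2 + 1) · s^d). -/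
open MeasureTheory Set

/-- The map `u ↦ 2 |u|` carries Lebesgue measure on `[-s/2, s/2]` to Lebesgue measure on `[0, s]`. -/
lemma measurePreserving_two_mul_abs (s : ℝ) :
    MeasurePreserving (fun u : ℝ => 2 * |u|)
      (volume.restrict (Icc (-(s / 2)) (s / 2))) (volume.restrict (Icc 0 s)) := by
  have hm : Measurable (fun u : ℝ => 2 * |u|) := by fun_prop
  refine ⟨hm, Measure.ext_of_Iic _ _ fun t => ?_⟩
  rw [Measure.map_apply hm measurableSet_Iic, Measure.restrict_apply (hm measurableSet_Iic),
    Measure.restrict_apply measurableSet_Iic]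
  have h₁ : (fun u : ℝ => 2 * |u|) ⁻¹' Iic t ∩ Icc (-(s / 2)) (s / 2)
      = Icc (-(min t s / 2)) (min t s / 2) := by
    ext u
    simp only [mem_inter_iff, mem_preimage, mem_Iic, mem_Icc, ← abs_le]
    rw [le_div_iff₀ two_pos, le_div_iff₀ two_pos, le_min_iff, mul_comm]
  have h₂ : Iic t ∩ Icc 0 s = Icc 0 (min t s) := by
    ext u
    simp only [mem_inter_iff, mem_Iic, mem_Icc, le_min_iff]
    tauto
  rw [h₁, h₂, Real.volume_Icc, Real.volume_Icc]
  congr 1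
  ring

/-- A rearrangement of `[0, s]` sending `w` to a point at distance at most `w` from `a`:
`[0, s - a]` is translated onto `[a, s]` and the rest is reflected onto `[0, a)`. -/
noncomputable def foldAt (s a w : ℝ) : ℝ := if w ≤ s - a then a + w else s - w

lemma measurable_foldAt (s a : ℝ) : Measurable (foldAt s a) :=
  Measurable.ite measurableSet_Iic (by fun_prop) (by fun_prop)

lemma abs_foldAt_sub_le {s a w : ℝ} (ha : a ≤ s) (hw : 0 ≤ w) : |foldAt s a w - a| ≤ w := by
  unfold foldAt
  split_ifs with h <;> rw [abs_le] <;> constructor <;> linarith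

lemma measurePreserving_foldAt {s a : ℝ} (ha : a ∈ Icc 0 s) :
    MeasurePreserving (foldAt s a) (volume.restrict (Icc 0 s)) (volume.restrict (Icc 0 s)) := by
  obtain ⟨ha₀, has⟩ := ha
  have hm := measurable_foldAt s a
  refine ⟨hm, Measure.ext_of_Iic _ _ fun t => ?_⟩
  rw [Measure.map_apply hm measurableSet_Iic, Measure.restrict_apply (hm measurableSet_Iic),
    Measure.restrict_apply measurableSet_Iic]
  have h₂ : Iic t ∩ Icc 0 s = Icc 0 (min t s) := by
    ext u
    simp only [mem_inter_iff, mem_Iic, mem_Icc, le_min_iff]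
    tauto
  rw [h₂, Real.volume_Icc]
  rcases lt_or_ge t a with hta | hta
  · have h₁ : foldAt s a ⁻¹' Iic t ∩ Icc 0 s = Icc (s - t) s := by
      ext w
      simp only [mem_inter_iff, mem_preimage, mem_Iic, mem_Icc, foldAt]
      split_ifs with h
      · constructor
        · rintro ⟨h1, h2, h3⟩; constructor <;> linarith
        · rintro ⟨h1, h2⟩; linarith
      · constructor
        · rintro ⟨h1, h2, h3⟩; constructor <;> linarith
        · rintro ⟨h1, h2⟩; refine ⟨?_, ?_, ?_⟩ <;> linarith
    rw [h₁, Real.volume_Icc, min_eq_left (by linarith)]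
    congr 1
    ring
  · have h₁ : foldAt s a ⁻¹' Iic t ∩ Icc 0 s = Icc 0 (min t s - a) ∪ Ioc (s - a) s := by
      ext w
      simp only [mem_inter_iff, mem_preimage, mem_Iic, mem_Icc, foldAt, mem_union, mem_Ioc,
        le_sub_iff_add_le, le_min_iff]
      split_ifs with h
      · constructor
        · rintro ⟨h1, h2, h3⟩; left; refine ⟨?_, ?_, ?_⟩ <;> linarith
        · rintro (⟨h1, h2, h3⟩ | ⟨h1, h2⟩)
          · refine ⟨?_, ?_, ?_⟩ <;> linarith
          · linarith
      · constructor
        · rintro ⟨h1, h2, h3⟩; right; constructor <;> linarith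
        · rintro (⟨h1, h2, h3⟩ | ⟨h1, h2⟩)
          · linarith
          · refine ⟨?_, ?_, ?_⟩ <;> linarith
    have hdisj : Disjoint (Icc 0 (min t s - a)) (Ioc (s - a) s) := by
      rw [Set.disjoint_left]
      rintro w ⟨-, h1⟩ ⟨h2, -⟩
      linarith [min_le_right t s]
    rw [h₁, measure_union hdisj measurableSet_Ioc, Real.volume_Icc, Real.volume_Ioc,
      ← ENNReal.ofReal_add (by linarith [le_min hta has]) (by linarith)]
    congr 1
    ring

lemma EuclideanSpace.volume_cube {ι : Type*} [Fintype ι] {s : ℝ} (hs : 0 ≤ s) :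
    volume {x : EuclideanSpace ℝ ι | ∀ j, x j ∈ Icc 0 s}
      = ENNReal.ofReal (s ^ Fintype.card ι) := by
  have h : {x : EuclideanSpace ℝ ι | ∀ j, x j ∈ Icc 0 s}
      = WithLp.ofLp ⁻¹' (Set.univ.pi fun _ => Icc 0 s) := by
    ext x; simp [-pi_univ_Icc]
  rw [h, (PiLp.volume_preserving_ofLp ι).measure_preimage
    (MeasurableSet.univ_pi fun _ => measurableSet_Icc).nullMeasurableSet, volume_pi_pi]
  simp [ENNReal.ofReal_pow hs]

/-- A ball of radius `r ≤ s` centred in the cube `[0, s]^d` meets the cube in at least the volume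
of a ball of radius `r / 2`. -/
lemma EuclideanSpace.volume_closedBall_half_le_inter_cube {ι : Type*} [Fintype ι] {s r : ℝ}
    (hrs : r ≤ s) {a : EuclideanSpace ℝ ι} (ha : ∀ j, a j ∈ Icc 0 s) :
    volume (Metric.closedBall (0 : EuclideanSpace ℝ ι) (r / 2)) ≤
      volume (Metric.closedBall a r ∩ {x : EuclideanSpace ℝ ι | ∀ j, x j ∈ Icc 0 s}) := by
  have hmp := measurePreserving_pi (fun _ : ι => volume.restrict (Icc (-(s / 2)) (s / 2)))
    (fun _ : ι => volume.restrict (Icc 0 s))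
    (fun j => (measurePreserving_foldAt (ha j)).comp (measurePreserving_two_mul_abs s))
  rw [← Measure.restrict_pi_pi, ← Measure.restrict_pi_pi, ← volume_pi] at hmp
  have hto := PiLp.volume_preserving_toLp ι
  have hball (c : EuclideanSpace ℝ ι) (ρ : ℝ) :
      MeasurableSet (WithLp.toLp 2 ⁻¹' Metric.closedBall c ρ : Set (ι → ℝ)) :=
    hto.measurable measurableSet_closedBall
  have hcube : MeasurableSet {x : EuclideanSpace ℝ ι | ∀ j, x j ∈ Icc 0 s} := by
    simp only [Set.ofPred_forall]
    exact MeasurableSet.iInter fun j =>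
      (show Measurable fun x : EuclideanSpace ℝ ι => x j by fun_prop) measurableSet_Icc
  have hset : (WithLp.toLp 2 ⁻¹'
      (Metric.closedBall a r ∩ {x : EuclideanSpace ℝ ι | ∀ j, x j ∈ Icc 0 s}) : Set (ι → ℝ))
      = WithLp.toLp 2 ⁻¹' Metric.closedBall a r ∩ Set.univ.pi fun _ => Icc 0 s := by
    ext x; simp [-pi_univ_Icc]
  rw [← hto.measure_preimage (measurableSet_closedBall.inter hcube).nullMeasurableSet,
    ← hto.measure_preimage measurableSet_closedBall.nullMeasurableSet, hset,
    ← Measure.restrict_apply (hball a r), ← hmp.measure_preimage (hball a r).nullMeasurableSet,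
    Measure.restrict_apply (hmp.measurable (hball a r))]
  refine measure_mono fun u hu => ?_
  have hu' : ‖WithLp.toLp 2 u‖ ≤ r / 2 := by simpa using hu
  refine ⟨?_, fun j _ => ?_⟩
  · have hle : ‖WithLp.toLp 2 (fun j => foldAt s (a j) (2 * |u j|)) - a‖
        ≤ ‖(2 : ℝ) • WithLp.toLp 2 u‖ := by
      rw [EuclideanSpace.norm_eq, EuclideanSpace.norm_eq]
      refine Real.sqrt_le_sqrt (Finset.sum_le_sum fun j _ => ?_)
      have := abs_foldAt_sub_le (ha j).2 (w := 2 * |u j|) (by positivity)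
      simp only [PiLp.sub_apply, PiLp.smul_apply, smul_eq_mul, norm_mul, Real.norm_eq_abs,
        Nat.abs_ofNat]
      gcongr
    rw [norm_smul, Real.norm_two] at hle
    simp only [mem_preimage, mem_closedBall_iff_norm, Function.comp_def]
    linarith
  · rw [mem_Icc, ← abs_le]
    have := PiLp.norm_apply_le (WithLp.toLp 2 u) j
    simp only [Real.norm_eq_abs] at this
    linarith

/-- `EuclideanSpace.volume_closedBall` including dimension zero, for nonnegative radii. -/
lemma EuclideanSpace.volume_closedBall_of_nonneg {ι : Type*} [Fintype ι]
    (x : EuclideanSpace ℝ ι) {r : ℝ} (hr : 0 ≤ r) :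
    volume (Metric.closedBall x r) = ENNReal.ofReal (r ^ Fintype.card ι *
      (√Real.pi ^ Fintype.card ι / Real.Gamma (Fintype.card ι / 2 + 1))) := by
  cases isEmpty_or_nonempty ι
  · have : Metric.closedBall x r = {x : EuclideanSpace ℝ ι | ∀ j, x j ∈ Icc (0 : ℝ) 1} := by
      ext y
      simp [Subsingleton.elim y x, hr]
    rw [this, EuclideanSpace.volume_cube zero_le_one]
    simp
  · rw [EuclideanSpace.volume_closedBall, ENNReal.ofReal_mul (by positivity),
      ENNReal.ofReal_pow hr]

/-- With `𝒳 = [0,s]^d` (`s > 0`), `f` `L`-Lipschitz (`L > 0`) with global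
maximizer `x* ∈ 𝒳`, and `ε > 0` with `ε/L ≤ s`: if `X` is uniformly distributed on `𝒳`
(normalized Lebesgue measure on `𝒳`), then
`P(f(x*) - f(X) ≤ ε) ≥ π^(d/2) (ε/L)^d / (2^d Γ(d/2+1) s^d)`. -/
theorem uniform_sample_eps_optimal_prob {d : ℕ} (s : ℝ) (hs : 0 < s)
    (f : EuclideanSpace ℝ (Fin d) → ℝ) (L : ℝ) (hL : 0 < L)
    (hf : ∀ x x' : EuclideanSpace ℝ (Fin d), |f x - f x'| ≤ L * ‖x - x'‖)
    (xstar : EuclideanSpace ℝ (Fin d)) (hxstar : ∀ j, xstar j ∈ Set.Icc 0 s)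
    (hopt : ∀ x : EuclideanSpace ℝ (Fin d), (∀ j, x j ∈ Set.Icc 0 s) → f x ≤ f xstar)
    (ε : ℝ) (hε : 0 < ε) (hεs : ε / L ≤ s)
    (μ : MeasureTheory.Measure (EuclideanSpace ℝ (Fin d)))
    (hμ : μ = (MeasureTheory.volume
          {x : EuclideanSpace ℝ (Fin d) | ∀ j, x j ∈ Set.Icc 0 s})⁻¹ •
        MeasureTheory.volume.restrict
          {x : EuclideanSpace ℝ (Fin d) | ∀ j, x j ∈ Set.Icc 0 s}) :
    ENNReal.ofReal (Real.pi ^ ((d : ℝ) / 2) * (ε / L) ^ d /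
        (2 ^ d * Real.Gamma ((d : ℝ) / 2 + 1) * s ^ d)) ≤
      μ {x : EuclideanSpace ℝ (Fin d) | f xstar - f x ≤ ε} := by
  have hr : 0 < ε / L := div_pos hε hL
  have hcube := EuclideanSpace.volume_cube (ι := Fin d) hs.le
  have hsub : Metric.closedBall xstar (ε / L) ⊆ {x | f xstar - f x ≤ ε} := by
    intro x hx
    rw [mem_closedBall_iff_norm', le_div_iff₀' hL] at hx
    exact (le_abs_self _).trans ((hf xstar x).trans hx)
  have hlower := EuclideanSpace.volume_closedBall_half_le_inter_cube hεs hxstar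
  rw [EuclideanSpace.volume_closedBall_of_nonneg _ (by positivity)] at hlower
  have hpi : √Real.pi ^ d = Real.pi ^ ((d : ℝ) / 2) := by
    rw [Real.sqrt_eq_rpow, ← Real.rpow_mul_natCast Real.pi_pos.le]
    congr 1
    ring
  simp only [Fintype.card_fin, hpi] at hlower hcube
  have hΓ : 0 < Real.Gamma ((d : ℝ) / 2 + 1) := Real.Gamma_pos_of_pos (by positivity)
  rw [hμ]
  refine le_trans ?_ (measure_mono hsub)
  rw [Measure.smul_apply, Measure.restrict_apply measurableSet_closedBall, smul_eq_mul, hcube,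
    ← ENNReal.ofReal_inv_of_pos (by positivity)]
  refine le_trans (le_of_eq ?_) (mul_le_mul_right hlower _)
  rw [← ENNReal.ofReal_mul (by positivity)]
  congr 1
  rw [div_pow (ε / L) 2]
  field_simp
end

section
/- Let μ ∈ ℝ, σ > 0, y* ∈ ℝ, and let a ≤ b be real numbers. Let X be a real random variable with the Gaussian distribution of mean μ and variance σ². Then ∫_{a}^{b} (x - y*) · (1/(σ√(2π))) exp( -(x-μ)²/(2σ²) ) dx = σ · z(y*) · ( Φ(z(a)) - Φ(z(b)) ) + σ · ( φ(z(a)) - φ(z(b)) ), where z(v) = (μ - v)/σ, φ is the standard normal probability density function, and Φ is the standard normal cumulative distribution function. -/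
/-- The standard normal probability density function `φ(t) = (1/√(2π)) exp(-t²/2)`. -/
noncomputable def stdNormalPDF (t : ℝ) : ℝ :=
  (Real.sqrt (2 * Real.pi))⁻¹ * Real.exp (-t ^ 2 / 2)

/-- The standard normal cumulative distribution function `Φ(t) = ∫_{-∞}^t φ(u) du`. -/
noncomputable def stdNormalCDF (t : ℝ) : ℝ :=
  ∫ u in Set.Iic t, stdNormalPDF u

theorem continuous_stdNormalPDF : Continuous stdNormalPDF := by
  unfold stdNormalPDF
  fun_prop

theorem integrable_stdNormalPDF : MeasureTheory.Integrable stdNormalPDF := by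
  refine (ProbabilityTheory.integrable_gaussianPDFReal 0 1).congr ?_
  filter_upwards with t
  simp [ProbabilityTheory.gaussianPDFReal, stdNormalPDF]

theorem hasDerivAt_stdNormalPDF (t : ℝ) :
    HasDerivAt stdNormalPDF (-t * stdNormalPDF t) t := by
  have h : HasDerivAt (fun u : ℝ => -u ^ 2 / 2) (-t) t := by
    refine ((hasDerivAt_pow 2 t).neg.div_const 2).congr_deriv ?_
    push_cast
    ring
  refine (h.exp.const_mul (Real.sqrt (2 * Real.pi))⁻¹).congr_deriv ?_
  unfold stdNormalPDF
  ring

theorem hasDerivAt_stdNormalCDF (t : ℝ) :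
    HasDerivAt stdNormalCDF (stdNormalPDF t) t := by
  have h : stdNormalCDF = fun t => stdNormalCDF 0 + ∫ u in (0 : ℝ)..t, stdNormalPDF u := by
    funext t
    rw [← intervalIntegral.integral_Iic_sub_Iic integrable_stdNormalPDF.integrableOn
      integrable_stdNormalPDF.integrableOn]
    unfold stdNormalCDF
    ring
  rw [h]
  exact (continuous_stdNormalPDF.integral_hasStrictDerivAt 0 t).hasDerivAt.const_add _

/-- Closed form of the truncated expected improvement: for `σ > 0`,
`a ≤ b`, and `z(v) = (μ - v)/σ`,
`∫_a^b (x - y*) (1/(σ√(2π))) exp(-(x-μ)²/(2σ²)) dx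
  = σ z(y*) (Φ(z(a)) - Φ(z(b))) + σ (φ(z(a)) - φ(z(b)))`. -/
theorem truncated_expected_improvement_closed_form
    (μ σ ystar a b : ℝ) (hσ : 0 < σ) (hab : a ≤ b) :
    ∫ x in a..b, (x - ystar) *
        ((σ * Real.sqrt (2 * Real.pi))⁻¹ * Real.exp (-(x - μ) ^ 2 / (2 * σ ^ 2))) =
      σ * ((μ - ystar) / σ) * (stdNormalCDF ((μ - a) / σ) - stdNormalCDF ((μ - b) / σ)) +
        σ * (stdNormalPDF ((μ - a) / σ) - stdNormalPDF ((μ - b) / σ)) := by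
  have hz : ∀ x, HasDerivAt (fun v : ℝ => (μ - v) / σ) (-1 / σ) x := fun x =>
    ((hasDerivAt_id x).const_sub μ).div_const σ
  have hF : ∀ x ∈ Set.uIcc a b, HasDerivAt
      (fun v => -(σ * ((μ - ystar) / σ) * stdNormalCDF ((μ - v) / σ) +
        σ * stdNormalPDF ((μ - v) / σ)))
      ((x - ystar) *
        ((σ * Real.sqrt (2 * Real.pi))⁻¹ * Real.exp (-(x - μ) ^ 2 / (2 * σ ^ 2)))) x := by
    intro x _
    have hpdf : (σ * Real.sqrt (2 * Real.pi))⁻¹ * Real.exp (-(x - μ) ^ 2 / (2 * σ ^ 2)) =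
        σ⁻¹ * stdNormalPDF ((μ - x) / σ) := by
      have he : -(x - μ) ^ 2 / (2 * σ ^ 2) = -((μ - x) / σ) ^ 2 / 2 := by
        field_simp
        ring
      rw [stdNormalPDF, he, mul_inv, mul_assoc]
    rw [hpdf]
    refine (((((hasDerivAt_stdNormalCDF _).comp x (hz x)).const_mul
      (σ * ((μ - ystar) / σ))).add
      (((hasDerivAt_stdNormalPDF _).comp x (hz x)).const_mul σ)).neg).congr_deriv ?_
    field_simp
    ring
  rw [intervalIntegral.integral_eq_sub_of_hasDerivAt hF
    (Continuous.intervalIntegrable (by fun_prop) a b)]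
  ring
end
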